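/- arXiv:math/0406318 — 3 statements merged into one kernel-verified Lean document; each statement's English description precedes it below -/
import Mathlib

section
/- Let F be a finite-dimensional normed vector space over ℂ, let p : ℂⁿ → F be an analytic (C^∞ suffices) map, let t : ℂ → ℂⁿ be differentiable at 0, and for every multi-index I ∈ ℕⁿ with |I| ≤ m let α_I : ℂ → ℂ be differentiable at 0. Define γ : ℂ → F by γ(s) = Σ_{|I| ≤ m} α_I(s) • ∂^I p(t(s)). Then the derivative γ'(0) lies in W_{m+1}(t(0)), the ℂ-linear span of the iterated partial derivatives {∂^J p(t(0)) : |J| ≤ m+1}. -/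
/-- The partial derivative of `f : ℂⁿ → F` in the `j`-th coordinate direction. -/
noncomputable def pd {n : ℕ} {F : Type*} [NormedAddCommGroup F] [NormedSpace ℂ F]
    (j : Fin n) (f : (Fin n → ℂ) → F) : (Fin n → ℂ) → F :=
  fun t => fderiv ℂ f t (Pi.single j 1)

/-- The iterated partial derivative `∂^I f = ∂₁^{i₁} ⋯ ∂ₙ^{iₙ} f` for a multi-index
`I : Fin n → ℕ`. -/
noncomputable def pdI {n : ℕ} {F : Type*} [NormedAddCommGroup F] [NormedSpace ℂ F]
    (I : Fin n → ℕ) (f : (Fin n → ℂ) → F) : (Fin n → ℂ) → F :=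
  (List.finRange n).foldr (fun j g => (pd j)^[I j] g) f

/-- The finite set of multi-indices `I ∈ ℕⁿ` with `|I| ≤ m`. -/
def multiIdx (n m : ℕ) : Finset (Fin n → ℕ) :=
  (Fintype.piFinset fun _ : Fin n => Finset.range (m + 1)).filter fun I => ∑ j, I j ≤ m

open scoped ContDiff in
lemma pd_smooth {n : ℕ} {F : Type*} [NormedAddCommGroup F] [NormedSpace ℂ F]
    (j : Fin n) {f : (Fin n → ℂ) → F} (hf : ContDiff ℂ ∞ f) : ContDiff ℂ ∞ (pd j f) := by
  unfold pd
  exact (hf.fderiv_right (m := ∞) (by simp)).clm_apply contDiff_const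

open scoped ContDiff in
lemma pd_iter_smooth {n : ℕ} {F : Type*} [NormedAddCommGroup F] [NormedSpace ℂ F]
    (j : Fin n) (k : ℕ) {f : (Fin n → ℂ) → F} (hf : ContDiff ℂ ∞ f) :
    ContDiff ℂ ∞ ((pd j)^[k] f) := by
  induction k with
  | zero => exact hf
  | succ k ih => rw [Function.iterate_succ_apply']; exact pd_smooth j ih

open scoped ContDiff in
lemma pd_comm {n : ℕ} {F : Type*} [NormedAddCommGroup F] [NormedSpace ℂ F]
    (i j : Fin n) {f : (Fin n → ℂ) → F} (hf : ContDiff ℂ ∞ f) :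
    pd i (pd j f) = pd j (pd i f) := by
  have hd : Differentiable ℂ (fderiv ℂ f) :=
    (hf.fderiv_right (m := ∞) (by simp)).differentiable (by simp)
  have key : ∀ (a b : Fin n) (x : Fin n → ℂ), pd a (pd b f) x =
      fderiv ℂ (fderiv ℂ f) x (Pi.single a 1) (Pi.single b 1) := by
    intro a b x
    unfold pd
    rw [fderiv_clm_apply (hd x) (differentiableAt_const _)]
    simp
  funext x
  rw [key, key]
  have hs : IsSymmSndFDerivAt ℂ f x := by
    apply ContDiffAt.isSymmSndFDerivAt (n := ∞) hf.contDiffAt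
    simp only [minSmoothness_of_isRCLikeNormedField]
    exact WithTop.coe_le_coe.mpr (le_top : (2 : ℕ∞) ≤ ⊤)
  exact hs _ _

open scoped ContDiff in
lemma pd_iter_comm {n : ℕ} {F : Type*} [NormedAddCommGroup F] [NormedSpace ℂ F]
    (i j : Fin n) (k : ℕ) {f : (Fin n → ℂ) → F} (hf : ContDiff ℂ ∞ f) :
    pd i ((pd j)^[k] f) = (pd j)^[k] (pd i f) := by
  induction k with
  | zero => rfl
  | succ k ih =>
    rw [Function.iterate_succ_apply', Function.iterate_succ_apply',
      pd_comm i j (pd_iter_smooth j k hf), ih]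

open scoped ContDiff in
lemma fold_smooth {n : ℕ} {F : Type*} [NormedAddCommGroup F] [NormedSpace ℂ F]
    (l : List (Fin n)) (I : Fin n → ℕ) {f : (Fin n → ℂ) → F} (hf : ContDiff ℂ ∞ f) :
    ContDiff ℂ ∞ (l.foldr (fun j g => (pd j)^[I j] g) f) := by
  induction l with
  | nil => exact hf
  | cons a l ih => exact pd_iter_smooth a _ ih

lemma fold_congr {n : ℕ} {F : Type*} [NormedAddCommGroup F] [NormedSpace ℂ F]
    (l : List (Fin n)) (I J : Fin n → ℕ) (f : (Fin n → ℂ) → F) (h : ∀ j ∈ l, I j = J j) :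
    l.foldr (fun j g => (pd j)^[I j] g) f = l.foldr (fun j g => (pd j)^[J j] g) f := by
  induction l with
  | nil => rfl
  | cons a l ih =>
    simp only [List.foldr_cons]
    rw [ih (fun j hj => h j (List.mem_cons_of_mem _ hj)), h a List.mem_cons_self]

open scoped ContDiff in
lemma pd_fold {n : ℕ} {F : Type*} [NormedAddCommGroup F] [NormedSpace ℂ F]
    (l : List (Fin n)) (hl : l.Nodup) (i : Fin n) (hi : i ∈ l) (I : Fin n → ℕ)
    {f : (Fin n → ℂ) → F} (hf : ContDiff ℂ ∞ f) :
    pd i (l.foldr (fun j g => (pd j)^[I j] g) f) =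
      l.foldr (fun j g => (pd j)^[(I + Pi.single i 1 : Fin n → ℕ) j] g) f := by
  induction l with
  | nil => simp at hi
  | cons a l ih =>
    rw [List.nodup_cons] at hl
    simp only [List.foldr_cons]
    by_cases h : i = a
    · subst h
      rw [fold_congr l (I + Pi.single i 1) I f, ← Function.iterate_succ_apply' (pd i)]
      · simp
      · intro j hj
        have : j ≠ i := fun e => hl.1 (e ▸ hj)
        simp [this]
    · have hi' : i ∈ l := by simpa [h] using hi
      rw [pd_iter_comm i a _ (fold_smooth l I hf), ih hl.2 hi']
      simp [Ne.symm h]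

open scoped ContDiff in
lemma pd_pdI {n : ℕ} {F : Type*} [NormedAddCommGroup F] [NormedSpace ℂ F]
    (i : Fin n) (I : Fin n → ℕ) {f : (Fin n → ℂ) → F} (hf : ContDiff ℂ ∞ f) :
    pd i (pdI I f) = pdI (I + Pi.single i 1) f :=
  pd_fold _ (List.nodup_finRange n) i (List.mem_finRange i) I hf

/-- If `p : ℂⁿ → F` is `C^∞`, `t : ℂ → ℂⁿ` is differentiable at `0`, each `α_I : ℂ → ℂ`
(`|I| ≤ m`) is differentiable at `0`, and `γ(s) = Σ_{|I| ≤ m} α_I(s) • ∂^I p(t(s))`,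
then `γ'(0)` lies in the ℂ-linear span of `{∂^J p(t(0)) : |J| ≤ m + 1}`. -/
theorem deriv_mem_span_osculating {n m : ℕ} {F : Type*} [NormedAddCommGroup F]
    [NormedSpace ℂ F] [FiniteDimensional ℂ F]
    (p : (Fin n → ℂ) → F) (hp : ContDiff ℂ ⊤ p)
    (t : ℂ → Fin n → ℂ) (ht : DifferentiableAt ℂ t 0)
    (α : (Fin n → ℕ) → ℂ → ℂ)
    (hα : ∀ I ∈ multiIdx n m, DifferentiableAt ℂ (α I) 0) :
    deriv (fun s => ∑ I ∈ multiIdx n m, α I s • pdI I p (t s)) 0 ∈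
      Submodule.span ℂ
        {v : F | ∃ J : Fin n → ℕ, (∑ j, J j) ≤ m + 1 ∧ v = pdI J p (t 0)} := by
  have hp' : ContDiff ℂ (↑(⊤ : ℕ∞)) p := hp.of_le le_top
  have hd : ∀ I, Differentiable ℂ (pdI I p) := fun I =>
    (fold_smooth (List.finRange n) I hp').differentiable (by simp)
  have hder : ∀ I ∈ multiIdx n m, HasDerivAt (fun s => α I s • pdI I p (t s))
      (α I 0 • fderiv ℂ (pdI I p) (t 0) (deriv t 0) + deriv (α I) 0 • pdI I p (t 0)) 0 := by
    intro I hI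
    exact (hα I hI).hasDerivAt.smul
      ((hd I (t 0)).hasFDerivAt.comp_hasDerivAt (0 : ℂ) ht.hasDerivAt)
  rw [(HasDerivAt.fun_sum hder).deriv]
  refine Submodule.sum_mem _ fun I hI => ?_
  have hm : ∑ j, I j ≤ m := (Finset.mem_filter.mp hI).2
  refine Submodule.add_mem _ (Submodule.smul_mem _ _ ?_)
    (Submodule.smul_mem _ _ (Submodule.subset_span ⟨I, by omega, rfl⟩))
  have hv : deriv t 0 = ∑ i, (deriv t 0 i) • (Pi.single i (1 : ℂ) : Fin n → ℂ) :=
    pi_eq_sum_univ' _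
  rw [hv, map_sum]
  refine Submodule.sum_mem _ fun i _ => ?_
  rw [map_smul]
  refine Submodule.smul_mem _ _ (Submodule.subset_span ⟨I + Pi.single i 1, ?_, ?_⟩)
  · simp [Finset.sum_add_distrib, hm]
  · rw [← pd_pdI i I hp']
    rfl
end

section
/- Let F be a finite-dimensional vector space over ℂ, let U ⊆ ℂⁿ be a connected open set, and let f_1, …, f_N : U → F be differentiable maps such that for every t ∈ U and every direction j ∈ {1,…,n}, the partial derivative ∂_j f_i(t) lies in the ℂ-linear span of {f_1(t), …, f_N(t)} for each i. Assume moreover that the dimension of span{f_1(t), …, f_N(t)} is the same for all t ∈ U. Then the subspace span{f_1(t), …, f_N(t)} ⊆ F is independent of t ∈ U, i.e., there is a single subspace W ⊆ F with span{f_1(t), …, f_N(t)} = W for all t ∈ U. -/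
theorem fderiv_mem_aux {n : ℕ} {F : Type*} [NormedAddCommGroup F] [NormedSpace ℂ F]
    (D : (Fin n → ℂ) →L[ℂ] F) (S : Submodule ℂ F)
    (h : ∀ j, D (Pi.single j 1) ∈ S) (v : Fin n → ℂ) : D v ∈ S := by
  rw [pi_eq_sum_univ' v, map_sum]
  refine Submodule.sum_mem _ fun j _ => ?_
  rw [map_smul]
  refine S.smul_mem _ ?_
  exact h j

theorem exists_maps_aux {N : ℕ} {F : Type*} [NormedAddCommGroup F]
    [NormedSpace ℂ F] [FiniteDimensional ℂ F] (g : Fin N → F)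
    (V : Submodule ℂ F) (hV : V = Submodule.span ℂ (Set.range g)) :
    ∃ (A : F →L[ℂ] V) (L : Fin N → (V →L[ℂ] ℂ)),
      (∀ v : V, A v = v) ∧ (∀ v : V, ∑ i, L i v • g i = (v : F)) := by
  obtain ⟨A, hA⟩ := LinearMap.exists_leftInverse_of_injective V.subtype V.ker_subtype
  let T : (Fin N → ℂ) →ₗ[ℂ] V := (Fintype.linearCombination ℂ g).codRestrict V (by
    intro c
    rw [hV, ← Fintype.range_linearCombination ℂ]
    exact ⟨c, rfl⟩)
  have hT : LinearMap.range T = ⊤ := by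
    rw [LinearMap.range_eq_top]
    rintro ⟨v, hv⟩
    have hv' := hv
    rw [hV, ← Fintype.range_linearCombination ℂ] at hv'
    obtain ⟨c, hc⟩ := hv'
    exact ⟨c, Subtype.ext hc⟩
  obtain ⟨s, hs⟩ := LinearMap.exists_rightInverse_of_surjective T hT
  refine ⟨LinearMap.toContinuousLinearMap A,
    fun i => LinearMap.toContinuousLinearMap ((LinearMap.proj i).comp s), ?_, ?_⟩
  · intro v
    exact LinearMap.congr_fun hA v
  · intro v
    have := congrArg Subtype.val (LinearMap.congr_fun hs v)
    simpa [T, Fintype.linearCombination_apply] using this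

theorem span_local_aux {n N : ℕ} {F : Type*} [NormedAddCommGroup F]
    [NormedSpace ℂ F] [FiniteDimensional ℂ F]
    (U : Set (Fin n → ℂ)) (hUopen : IsOpen U)
    (f : Fin N → (Fin n → ℂ) → F)
    (hf : ∀ i, DifferentiableOn ℂ (f i) U)
    (hder : ∀ t ∈ U, ∀ j : Fin n, ∀ i : Fin N,
      fderiv ℂ (f i) t (Pi.single j 1) ∈
        Submodule.span ℂ (Set.range fun i' => f i' t))
    (t₀ : Fin n → ℂ) (ht₀ : t₀ ∈ U)
    (hdim : ∀ t ∈ U,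
      Module.finrank ℂ (Submodule.span ℂ (Set.range fun i => f i t₀)) =
        Module.finrank ℂ (Submodule.span ℂ (Set.range fun i => f i t))) :
    ∀ᶠ t in nhds t₀, Submodule.span ℂ (Set.range fun i => f i t₀) ≤
      Submodule.span ℂ (Set.range fun i => f i t) := by
  obtain ⟨V, hV⟩ : ∃ V, V = Submodule.span ℂ (Set.range fun i => f i t₀) := ⟨_, rfl⟩
  rw [← hV] at hdim ⊢
  obtain ⟨A, L, hA, hL⟩ := exists_maps_aux (fun i => f i t₀) V hV
  let T : (Fin n → ℂ) → (V →L[ℂ] F) := fun t => ∑ i, (L i).smulRight (f i t)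
  have hTapp : ∀ t v, T t v = ∑ i, L i v • f i t := by
    intro t v; simp [T]
  have hTmem : ∀ t v, T t v ∈ Submodule.span ℂ (Set.range fun i => f i t) := by
    intro t v
    rw [hTapp]
    exact Submodule.sum_mem _ fun i _ =>
      Submodule.smul_mem _ _ (Submodule.subset_span ⟨i, rfl⟩)
  have hTd : ∀ t ∈ U, ∃ T' : (Fin n → ℂ) →L[ℂ] (V →L[ℂ] F), HasFDerivAt T T' t ∧
      ∀ h v, T' h v ∈ Submodule.span ℂ (Set.range fun i => f i t) := by
    intro t ht
    refine ⟨∑ i, (ContinuousLinearMap.smulRightL ℂ V F (L i)).comp (fderiv ℂ (f i) t), ?_, ?_⟩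
    · refine HasFDerivAt.fun_sum (𝕜 := ℂ) (E := Fin n → ℂ) (F := V →L[ℂ] F)
        (u := Finset.univ) (A := fun i t => (L i).smulRight (f i t))
        (A' := fun i => (ContinuousLinearMap.smulRightL ℂ V F (L i)).comp (fderiv ℂ (f i) t))
        fun i _ => ?_
      exact HasFDerivAt.comp (𝕜 := ℂ) t
        (g := ContinuousLinearMap.smulRightL ℂ V F (L i)) (f := f i)
        (ContinuousLinearMap.smulRightL ℂ V F (L i)).hasFDerivAt
        ((hf i).differentiableAt (hUopen.mem_nhds ht)).hasFDerivAt
    · intro h v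
      simp only [sum_apply, ContinuousLinearMap.comp_apply,
        ContinuousLinearMap.smulRightL_apply_apply, ContinuousLinearMap.smulRight_apply]
      exact Submodule.sum_mem _ fun i _ => Submodule.smul_mem _ _
        (fderiv_mem_aux _ _ (fun j => hder t ht j i) h)
  let B : (Fin n → ℂ) → (V →L[ℂ] V) := fun t => A.comp (T t)
  have hB0 : B t₀ = 1 := by
    ext v
    have h1 : T t₀ v = v := by rw [hTapp, hL]
    simp [B, h1, hA]
  have hTc : ContinuousAt T t₀ := by
    obtain ⟨T', h, -⟩ := hTd t₀ ht₀
    exact h.continuousAt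
  have hBc : ContinuousAt B t₀ := by
    exact continuousAt_const.clm_comp hTc
  have hunit : ∀ᶠ t in nhds t₀, IsUnit (B t) := by
    refine hBc.eventually (p := fun x => IsUnit x) ?_
    rw [hB0]
    have := (Units.isOpen (R := V →L[ℂ] V)).mem_nhds isUnit_one
    exact this
  obtain ⟨ε, hε, hball⟩ := Metric.eventually_nhds_iff_ball.1
    (hunit.and (hUopen.mem_nhds ht₀))
  have hmain : ∀ v : V, ∀ t ∈ Metric.ball t₀ ε,
      HasFDerivAt (fun t => T t (Ring.inverse (B t) v)) (0 : (Fin n → ℂ) →L[ℂ] F) t := by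
    intro v t ht
    obtain ⟨hu, htU⟩ := hball t ht
    obtain ⟨T', hT', hT'mem⟩ := hTd t htU
    have hBd : DifferentiableAt ℂ B t :=
      (differentiableAt_const A).clm_comp hT'.differentiableAt
    obtain ⟨u, hu⟩ := hu
    have hinv : DifferentiableAt ℂ (fun t => Ring.inverse (B t)) t := by
      have h1 : DifferentiableAt ℂ (Ring.inverse : (V →L[ℂ] V) → _) (B t) := by
        have hu' : IsUnit (B t) := ⟨u, hu⟩
        exact differentiableAt_inverse (𝕜 := ℂ) (R := V →L[ℂ] V) (x := B t) hu'
      exact DifferentiableAt.comp (𝕜 := ℂ) (E := Fin n → ℂ) (F := V →L[ℂ] V)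
        (G := V →L[ℂ] V) (g := Ring.inverse) (f := B) t h1 hBd
    have hRv : DifferentiableAt ℂ (fun t => Ring.inverse (B t) v) t :=
      hinv.clm_apply (differentiableAt_const v)
    have hD := hT'.clm_apply hRv.hasFDerivAt
    set D := (T t).comp (fderiv ℂ (fun t => Ring.inverse (B t) v) t) +
      T'.flip (Ring.inverse (B t) v) with hDdef
    suffices hD0 : D = 0 by rwa [hD0] at hD
    have hAD : A.comp D = 0 := by
      have h1 : HasFDerivAt (fun t => A (T t (Ring.inverse (B t) v))) (A.comp D) t :=
        A.hasFDerivAt.comp t hD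
      have h2 : (fun t => A (T t (Ring.inverse (B t) v))) =ᶠ[nhds t] fun _ => v := by
        filter_upwards [Metric.isOpen_ball.mem_nhds ht] with x hx
        have := Ring.mul_inverse_cancel (B x) (hball x hx).1
        exact congrArg (fun M : V →L[ℂ] V => M v) this
      exact h1.unique ((hasFDerivAt_const v t).congr_of_eventuallyEq h2)
    have hBinj : Function.Injective (B t) := by
      intro x y hxy
      have h := Ring.inverse_mul_cancel (B t) ⟨u, hu⟩
      have hx := congrArg (fun M : V →L[ℂ] V => M x) h
      have hy := congrArg (fun M : V →L[ℂ] V => M y) h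
      simp only [mul_apply_eq_comp, one_apply_eq_self] at hx hy
      rw [← hx, ← hy, hxy]
    have hTinj : Function.Injective (T t) := fun x y hxy =>
      hBinj (congrArg A hxy)
    have hrange : LinearMap.range (T t : V →ₗ[ℂ] F) =
        Submodule.span ℂ (Set.range fun i => f i t) := by
      apply Submodule.eq_of_le_of_finrank_eq
      · rintro _ ⟨v, rfl⟩
        exact hTmem t v
      · rw [LinearMap.finrank_range_of_inj hTinj]
        exact hdim t htU
    ext1 h
    have hmem : D h ∈ Submodule.span ℂ (Set.range fun i => f i t) :=
      Submodule.add_mem _ (hTmem t _) (hT'mem h _)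
    rw [← hrange] at hmem
    obtain ⟨w, hw⟩ := hmem
    have hw' : T t w = D h := hw
    have h0 : B t w = B t 0 := by
      rw [map_zero]
      change A (T t w) = 0
      rw [hw']
      exact congrArg (fun M : (Fin n → ℂ) →L[ℂ] V => M h) hAD
    have := hBinj h0
    rw [← hw', this]; simp
  filter_upwards [Metric.ball_mem_nhds t₀ hε] with t ht v hv
  have hconst := (convex_ball t₀ ε).is_const_of_fderivWithin_eq_zero (𝕜 := ℂ)
    (f := fun t => T t (Ring.inverse (B t) ⟨v, hv⟩))
    (fun x hx => (hmain ⟨v, hv⟩ x hx).differentiableAt.differentiableWithinAt)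
    (fun x hx => by
      rw [fderivWithin_of_isOpen Metric.isOpen_ball hx]
      exact (hmain ⟨v, hv⟩ x hx).fderiv) (Metric.mem_ball_self hε) ht
  have h0 : T t₀ (Ring.inverse (B t₀) ⟨v, hv⟩) = v := by
    rw [hB0, Ring.inverse_one, one_apply_eq_self, hTapp, hL]
  have h1 : T t (Ring.inverse (B t) ⟨v, hv⟩) = v := hconst.symm.trans h0
  rw [← h1]
  exact hTmem t _

/-- Constant-span lemma: if `f₁, …, f_N : U → F` are differentiable on a connected open
`U ⊆ ℂⁿ`, every partial derivative `∂_j f_i(t)` lies in `span {f₁(t), …, f_N(t)}` at every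
`t ∈ U`, and `dim span {f₁(t), …, f_N(t)}` is the same for all `t ∈ U`, then the subspace
`span {f₁(t), …, f_N(t)}` is independent of `t ∈ U`. -/
theorem span_constant_of_deriv_mem_span {n N : ℕ} {F : Type*} [NormedAddCommGroup F]
    [NormedSpace ℂ F] [FiniteDimensional ℂ F]
    (U : Set (Fin n → ℂ)) (hUopen : IsOpen U) (hUconn : IsConnected U)
    (f : Fin N → (Fin n → ℂ) → F)
    (hf : ∀ i, DifferentiableOn ℂ (f i) U)
    (hder : ∀ t ∈ U, ∀ j : Fin n, ∀ i : Fin N,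
      fderiv ℂ (f i) t (Pi.single j 1) ∈
        Submodule.span ℂ (Set.range fun i' => f i' t))
    (hdim : ∀ s ∈ U, ∀ t ∈ U,
      Module.finrank ℂ (Submodule.span ℂ (Set.range fun i => f i s)) =
        Module.finrank ℂ (Submodule.span ℂ (Set.range fun i => f i t))) :
    ∃ W : Submodule ℂ F, ∀ t ∈ U,
      Submodule.span ℂ (Set.range fun i => f i t) = W := by
  classical
  have key : ∀ t₀ ∈ U, ∀ᶠ t in nhdsWithin t₀ U,
      Submodule.span ℂ (Set.range fun i => f i t₀) =
        Submodule.span ℂ (Set.range fun i => f i t) := by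
    intro t₀ ht₀
    rw [hUopen.nhdsWithin_eq ht₀]
    have h := span_local_aux U hUopen f hf hder t₀ ht₀ (fun t ht => hdim t₀ ht₀ t ht)
    filter_upwards [h, hUopen.mem_nhds ht₀] with t h1 h2
    exact Submodule.eq_of_le_of_finrank_eq h1 (hdim t₀ ht₀ t h2)
  obtain ⟨t₀, ht₀⟩ := hUconn.nonempty
  refine ⟨Submodule.span ℂ (Set.range fun i => f i t₀), fun t ht => ?_⟩
  exact hUconn.isPreconnected.induction₂
    (fun x y => Submodule.span ℂ (Set.range fun i => f i x) =
        Submodule.span ℂ (Set.range fun i => f i y)) key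
    (fun x y z _ _ _ h1 h2 => h1.trans h2) (fun x y _ _ h => h.symm) ht ht₀
end

section
/- Let F be a finite-dimensional normed vector space over ℂ, let U ⊆ ℂⁿ be a connected open set, and let p : U → F be analytic. Fix m ∈ ℕ and let d be the maximum over t ∈ U of the dimension of W_m(t), the ℂ-linear span of {∂^I p(t) : |I| ≤ m}. Then the set { t ∈ U : dim W_m(t) = d } is open and dense in U. -/
/-- The order-`m` osculating space `W_m(t)`: the ℂ-linear span of the iterated partial
derivatives `∂^I p(t)` with `|I| ≤ m`. -/
noncomputable def oscSpace {n : ℕ} {F : Type*} [NormedAddCommGroup F] [NormedSpace ℂ F]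
    (p : (Fin n → ℂ) → F) (m : ℕ) (t : Fin n → ℂ) : Submodule ℂ F :=
  Submodule.span ℂ {v : F | ∃ I : Fin n → ℕ, (∑ j, I j) ≤ m ∧ v = pdI I p t}

theorem pd_analytic {n : ℕ} {F : Type*} [NormedAddCommGroup F] [NormedSpace ℂ F]
    [CompleteSpace F] {U : Set (Fin n → ℂ)} (j : Fin n) {f : (Fin n → ℂ) → F}
    (hf : AnalyticOnNhd ℂ f U) : AnalyticOnNhd ℂ (pd j f) U := by
  intro t ht
  exact ((ContinuousLinearMap.apply ℂ F (Pi.single j 1 : Fin n → ℂ)).analyticAt _).comp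
    (hf.fderiv t ht)

theorem pdI_analytic {n : ℕ} {F : Type*} [NormedAddCommGroup F] [NormedSpace ℂ F]
    [CompleteSpace F] {U : Set (Fin n → ℂ)} (I : Fin n → ℕ) {f : (Fin n → ℂ) → F}
    (hf : AnalyticOnNhd ℂ f U) : AnalyticOnNhd ℂ (pdI I f) U := by
  unfold pdI
  induction List.finRange n with
  | nil => simpa using hf
  | cons j l ih =>
    rw [List.foldr_cons]
    induction I j with
    | zero => simpa using ih
    | succ k ihk =>
      rw [Function.iterate_succ_apply']
      exact pd_analytic j ihk

theorem exists_minor {n m : ℕ} {F : Type*} [NormedAddCommGroup F]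
    [NormedSpace ℂ F] [FiniteDimensional ℂ F] {U : Set (Fin n → ℂ)}
    {p : (Fin n → ℂ) → F} (hp : AnalyticOnNhd ℂ p U) (t₀ : Fin n → ℂ) :
    ∃ g : (Fin n → ℂ) → ℂ, AnalyticOnNhd ℂ g U ∧ g t₀ ≠ 0 ∧
      ∀ t, g t ≠ 0 →
        Module.finrank ℂ (oscSpace p m t₀) ≤ Module.finrank ℂ (oscSpace p m t) := by
  classical
  haveI : CompleteSpace F := FiniteDimensional.complete ℂ F
  obtain ⟨b, hbs, hspan, hli⟩ := exists_linearIndependent ℂ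
    {v : F | ∃ I : Fin n → ℕ, (∑ j, I j) ≤ m ∧ v = pdI I p t₀}
  haveI : Finite b := hli.finite
  haveI : Fintype b := Fintype.ofFinite b
  have hrank : Module.finrank ℂ (oscSpace p m t₀) = Fintype.card b := by
    unfold oscSpace
    rw [← hspan]
    have := finrank_span_eq_card hli
    rwa [Subtype.range_coe] at this
  choose I hI hv using fun x : b => hbs x.2
  obtain ⟨φ, hφ⟩ := LinearMap.exists_leftInverse_of_injective
    (Finsupp.linearCombination ℂ (Subtype.val : b → F)) (LinearMap.ker_eq_bot.2 hli)
  have hφ1 : ∀ x : b, φ x = Finsupp.single x 1 := by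
    intro x
    have := LinearMap.congr_fun hφ (Finsupp.single x 1)
    simpa using this
  let ψ : F →ₗ[ℂ] (b → ℂ) := (Finsupp.lcoeFun : (b →₀ ℂ) →ₗ[ℂ] b → ℂ) ∘ₗ φ
  let M : (Fin n → ℂ) → Matrix b b ℂ := fun t => Matrix.of fun x y => ψ (pdI (I x) p t) y
  refine ⟨fun t => (M t).det, ?_, ?_, ?_⟩
  · have hM : ∀ x y, AnalyticOnNhd ℂ (fun t => M t x y) U := by
      intro x y t ht
      let χ : F →L[ℂ] ℂ := LinearMap.toContinuousLinearMap (LinearMap.proj y ∘ₗ ψ)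
      exact (χ.analyticAt _).comp (pdI_analytic (I x) hp t ht)
    simp only [Matrix.det_apply']
    refine Finset.analyticOnNhd_fun_sum _ fun σ _ => ?_
    exact analyticOnNhd_const.mul (Finset.analyticOnNhd_fun_prod _ fun i _ => hM _ _)
  · have : M t₀ = 1 := by
      ext x y
      have : M t₀ x y = φ (pdI (I x) p t₀) y := rfl
      rw [this, ← hv, hφ1, Finsupp.single_apply, Matrix.one_apply]
    simp [this]
  · intro t ht
    have h1 : LinearIndependent ℂ (fun x : b => ψ (pdI (I x) p t)) :=
      Matrix.linearIndependent_rows_of_det_ne_zero ht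
    have h2 : LinearIndependent ℂ (fun x : b => pdI (I x) p t) := LinearIndependent.of_comp ψ h1
    rw [hrank, ← finrank_span_eq_card h2]
    apply Submodule.finrank_mono
    apply Submodule.span_mono
    rintro _ ⟨x, rfl⟩
    exact ⟨I x, hI x, rfl⟩

/-- If `p : U → F` is analytic on a connected open `U ⊆ ℂⁿ` and `d` is the maximum over
`t ∈ U` of `dim W_m(t)`, then the locus `{t ∈ U : dim W_m(t) = d}` is open and dense
in `U`. -/
theorem oscSpace_generic_dim_open_dense {n m d : ℕ} {F : Type*} [NormedAddCommGroup F]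
    [NormedSpace ℂ F] [FiniteDimensional ℂ F]
    (U : Set (Fin n → ℂ)) (hUopen : IsOpen U) (hUconn : IsConnected U)
    (p : (Fin n → ℂ) → F) (hp : AnalyticOnNhd ℂ p U)
    (hd : IsGreatest ((fun t => Module.finrank ℂ (oscSpace p m t)) '' U) d) :
    IsOpen {t | t ∈ U ∧ Module.finrank ℂ (oscSpace p m t) = d} ∧
      U ⊆ closure {t | t ∈ U ∧ Module.finrank ℂ (oscSpace p m t) = d} := by
  have key : ∀ t₀ ∈ U, Module.finrank ℂ (oscSpace p m t₀) = d →
      ∃ g : (Fin n → ℂ) → ℂ, AnalyticOnNhd ℂ g U ∧ g t₀ ≠ 0 ∧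
        ∀ t ∈ U, g t ≠ 0 → Module.finrank ℂ (oscSpace p m t) = d := by
    intro t₀ _ h
    obtain ⟨g, hg, hg0, hgt⟩ := exists_minor (m := m) hp t₀
    exact ⟨g, hg, hg0, fun t ht hne =>
      le_antisymm (hd.2 ⟨t, ht, rfl⟩) (h ▸ hgt t hne)⟩
  constructor
  · rw [isOpen_iff_mem_nhds]
    rintro t₀ ⟨ht₀, h⟩
    obtain ⟨g, hg, hg0, hgt⟩ := key t₀ ht₀ h
    filter_upwards [hUopen.mem_nhds ht₀, (hg t₀ ht₀).continuousAt.eventually_ne hg0]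
      with t ht hne
    exact ⟨ht, hgt t ht hne⟩
  · obtain ⟨t₀, ht₀, h⟩ := hd.1
    obtain ⟨g, hg, hg0, hgt⟩ := key t₀ ht₀ h
    intro t ht
    by_contra hcl
    apply hg0
    refine hg.eqOn_zero_of_preconnected_of_eventuallyEq_zero hUconn.isPreconnected ht ?_ ht₀
    filter_upwards [hUopen.mem_nhds ht, isClosed_closure.isOpen_compl.mem_nhds hcl] with s hs hsc
    by_contra hne
    exact hsc (subset_closure ⟨hs, hgt s hs hne⟩)
end
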